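/- Define R(k,n) := min{R ∈ ℕ : binom(k,R) ≥ n}. Let (k_N) be positive integers and (G_N) arbitrary finite groups with |G_N| → ∞, liminf_N (k_N − log_2|G_N|)/k_N > 0, and log k_N/log|G_N| → 0. Then, with Z_1,...,Z_{k_N} i.i.d. uniform on G_N, for every epsilon > 0 one has P(diam G_N^±(Z) ≤ (1 + epsilon)·R(k_N, |G_N|)) → 1 as N → ∞; that is, limsup_N diam G_N^±(Z)/R(k_N,|G_N|) ≤ 1 in probability. -/

import Mathlib

open Filter

/-- Graph distance from `x` to `y` in the Cayley graph of `G` with generators `z`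
(`⊤` if `y` is not reachable from `x`); undirected case allows inverses,
directed case (`undir = false`) only positive letters. -/
noncomputable def cayDist {G : Type*} [Group G] (undir : Bool) {k : ℕ}
    (z : Fin k → G) (x y : G) : ℕ∞ :=
  sInf {ℓ : ℕ∞ | ∃ n : ℕ, ℓ = (n : ℕ∞) ∧ ∃ w : Fin n → Fin k × Bool,
    (undir = false → ∀ i, (w i).2 = true) ∧
    y = x * (List.ofFn fun i => if (w i).2 then z (w i).1 else (z (w i).1)⁻¹).prod}

/-- Diameter of the Cayley graph of `G` with generators `z`
(`⊤` if not (strongly) connected). -/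
noncomputable def cayDiam {G : Type*} [Group G] (undir : Bool) {k : ℕ}
    (z : Fin k → G) : ℕ∞ :=
  ⨆ x : G, ⨆ y : G, cayDist undir z x y

/-- Probability, over a uniformly random `k`-tuple of elements of `G`, of the event `p`. -/
noncomputable def tupleProb (G : Type*) [Fintype G] (k : ℕ) (p : (Fin k → G) → Prop) : ℝ :=
  (Nat.card {z : Fin k → G // p z} : ℝ) / (Fintype.card G : ℝ) ^ k

/-- `R(k,n)`: the minimal `R` with `binom(k,R) ≥ n`. -/
noncomputable def minBinomRadius (k n : ℕ) : ℕ :=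
  sInf {R : ℕ | n ≤ k.choose R}

open Finset in
lemma card_filter_none_mul_card_le {Ω ι : Type*} [Fintype Ω] [DecidableEq ι] (A : Finset ι)
    (E : ι → Ω → Prop) [∀ i, DecidablePred (E i)] {n : ℝ} (hn : 0 < n)
    (h₁ : ∀ i ∈ A, (#{ω | E i ω} : ℝ) * n = Fintype.card Ω)
    (h₂ : ∀ i ∈ A, ∀ j ∈ A, i ≠ j → (#{ω | E i ω ∧ E j ω} : ℝ) * n * n = Fintype.card Ω) :
    (#{ω | ∀ i ∈ A, ¬ E i ω} : ℝ) * #A ≤ n * Fintype.card Ω := by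
  set M : ℝ := (Fintype.card Ω : ℝ) with hM
  have hM0 : 0 ≤ M := by positivity
  rcases A.eq_empty_or_nonempty with rfl | hA
  · simp only [card_empty, Nat.cast_zero, mul_zero]; positivity
  have ha : (0 : ℝ) < #A := by exact_mod_cast hA.card_pos
  set a : ℝ := (#A : ℝ) with hadef
  let X : Ω → ℝ := fun ω => ∑ i ∈ A, if E i ω then 1 else 0
  have hX1 : ∑ ω, X ω = a * (M / n) := by
    rw [sum_comm]
    have : ∀ i ∈ A, (∑ ω, if E i ω then (1 : ℝ) else 0) = M / n := by
      intro i hi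
      rw [sum_boole, eq_div_iff hn.ne', h₁ i hi]
    rw [sum_congr rfl this]; simp [hadef]
  have hX2 : ∑ ω, X ω ^ 2 ≤ a * (M / n) + a * a * (M / (n * n)) := by
    have e : ∀ ω, X ω ^ 2 = ∑ i ∈ A, ∑ j ∈ A, if E i ω ∧ E j ω then (1 : ℝ) else 0 := by
      intro ω
      rw [sq, sum_mul_sum]
      refine sum_congr rfl fun i _ => sum_congr rfl fun j _ => ?_
      by_cases h : E i ω <;> by_cases h' : E j ω <;> simp [h, h']
    simp_rw [e]
    rw [sum_comm]
    have : ∀ i ∈ A, (∑ ω, ∑ j ∈ A, if E i ω ∧ E j ω then (1 : ℝ) else 0)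
        ≤ M / n + a * (M / (n * n)) := by
      intro i hi
      rw [sum_comm]
      have : ∀ j ∈ A, (∑ ω, if E i ω ∧ E j ω then (1 : ℝ) else 0)
          ≤ (if i = j then M / n else 0) + M / (n * n) := by
        intro j hj
        rw [sum_boole]
        by_cases hij : i = j
        · subst hij
          have : 0 ≤ M / (n * n) := by positivity
          simp only [and_self, if_true]
          have := h₁ i hi
          rw [← eq_div_iff hn.ne'] at this
          linarith
        · have := h₂ i hi j hj hij
          rw [mul_assoc, ← eq_div_iff (by positivity)] at this
          simp [hij, this]
      refine (sum_le_sum this).trans ?_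
      rw [sum_add_distrib, sum_ite_eq]
      simp [hi, hadef]
    refine (sum_le_sum this).trans ?_
    simp only [sum_const, nsmul_eq_mul]
    rw [← hadef]
    apply le_of_eq; ring
  have hlow : (#{ω | ∀ i ∈ A, ¬ E i ω} : ℝ) * (a / n) ^ 2 ≤ ∑ ω, (X ω - a / n) ^ 2 := by
    calc _ = ∑ ω with ∀ i ∈ A, ¬ E i ω, (X ω - a / n) ^ 2 := by
          rw [← nsmul_eq_mul, ← sum_const]
          refine sum_congr rfl fun ω hω => ?_
          have : X ω = 0 := sum_eq_zero fun i hi => by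
            simp [(mem_filter.1 hω).2 i hi]
          rw [this]; ring
      _ ≤ _ := sum_le_sum_of_subset_of_nonneg (filter_subset _ _) fun _ _ _ => sq_nonneg _
  have hup : ∑ ω, (X ω - a / n) ^ 2 ≤ a * (M / n) := by
    have : ∑ ω, (X ω - a / n) ^ 2 = ∑ ω, X ω ^ 2 - 2 * (a / n) * ∑ ω, X ω + M * (a / n) ^ 2 := by
      simp_rw [sub_sq]
      rw [sum_add_distrib, sum_sub_distrib, mul_sum]
      simp only [sum_const, card_univ, nsmul_eq_mul]
      congr 2
      exact sum_congr rfl fun _ _ => by ring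
    rw [this, hX1]
    have e : 2 * (a / n) * (a * (M / n)) = 2 * (a * a * (M / (n * n))) := by field_simp
    have e' : M * (a / n) ^ 2 = a * a * (M / (n * n)) := by field_simp
    rw [e, e']; linarith
  have := hlow.trans hup
  have e : a * (M / n) = (n * M) * (a / n ^ 2) := by field_simp
  have e' : (#{ω | ∀ i ∈ A, ¬ E i ω} : ℝ) * (a / n) ^ 2
      = (#{ω | ∀ i ∈ A, ¬ E i ω} * a) * (a / n ^ 2) := by field_simp
  rw [e, e'] at this
  exact le_of_mul_le_mul_right this (by positivity)

open Finset in
lemma card_filter_bijective_coord {ι G : Type*} [Fintype ι] [DecidableEq ι] [Fintype G]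
    [DecidableEq G] (f : (ι → G) → G) (P : (ι → G) → Prop) [DecidablePred P] (i : ι)
    (hf : ∀ z, Function.Bijective fun x => f (Function.update z i x))
    (hP : ∀ z x, P (Function.update z i x) ↔ P z) (g : G) :
    #{z | f z = g ∧ P z} * Fintype.card G = #{z | P z} := by
  rw [← card_univ, ← card_product]
  refine card_bij (fun p _ => Function.update p.1 i p.2) ?_ ?_ ?_
  · rintro ⟨z, x⟩ h
    simp only [mem_product, mem_filter, mem_univ, true_and, and_true] at h ⊢
    exact (hP z x).2 h.2
  · rintro ⟨z, x⟩ h ⟨z', x'⟩ h' e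
    simp only [mem_product, mem_filter, mem_univ, true_and, and_true] at h h' e
    have hx : x = x' := by simpa using congrFun e i
    have hz : Function.update z' i (z i) = z := by
      ext1 j
      by_cases hj : j = i
      · subst hj; simp
      · have := congrFun e j
        simp only [Function.update_of_ne hj] at this ⊢
        exact this.symm
    have : z i = z' i := by
      apply (hf z').1
      simp only [hz, Function.update_eq_self, h.1, h'.1]
    rw [this, Function.update_eq_self] at hz
    rw [hz, hx]
  · intro w hw
    simp only [mem_filter, mem_univ, true_and] at hw
    obtain ⟨x, hx⟩ := (hf w).2 g
    refine ⟨(Function.update w i x, w i), ?_, by simp⟩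
    simp only [mem_product, mem_filter, mem_univ, true_and, and_true]
    exact ⟨hx, (hP w x).2 hw⟩

lemma List.prod_map_update_of_notMem {ι G : Type*} [DecidableEq ι] [Group G] {l : List ι} {i : ι}
    (h : i ∉ l) (z : ι → G) (x : G) :
    (l.map (Function.update z i x)).prod = (l.map z).prod := by
  congr 1
  refine List.map_congr_left fun j hj => Function.update_of_ne ?_ _ _
  rintro rfl; exact h hj

lemma List.bijective_prod_map_update {ι G : Type*} [DecidableEq ι] [Group G] {l : List ι} {i : ι}
    (hl : l.Nodup) (h : i ∈ l) (z : ι → G) :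
    Function.Bijective fun x => (l.map (Function.update z i x)).prod := by
  obtain ⟨s, t, rfl⟩ := List.append_of_mem h
  have hs : i ∉ s := fun hs => by
    have := List.disjoint_of_nodup_append hl hs; simp at this
  have ht : i ∉ t := by
    have := (List.nodup_append.1 hl).2.1
    exact (List.nodup_cons.1 this).1
  have : (fun x => ((s ++ i :: t).map (Function.update z i x)).prod)
      = fun x => (s.map z).prod * (x * (t.map z).prod) := by
    ext1 x
    simp [List.prod_map_update_of_notMem hs, List.prod_map_update_of_notMem ht]
  rw [this]
  exact (Group.mulLeft_bijective _).comp (Group.mulRight_bijective _)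

/-- The elements of `G` that are not an increasing product of exactly `L` of the `z i`. -/
noncomputable def missedElements {G : Type*} [Group G] [Fintype G] {K : ℕ} (L : ℕ)
    (z : Fin K → G) : Finset G :=
  open Classical in
  {g | ∀ S ∈ Finset.powersetCard L (Finset.univ : Finset (Fin K)), ((S.sort (· ≤ ·)).map z).prod ≠ g}

open Finset Classical in
lemma card_missing_mul_choose_le {G : Type*} [Group G] [Fintype G] (K : ℕ) {L : ℕ} (hL : 0 < L)
    (g : G) :
    (#{z : Fin K → G | g ∈ missedElements L z} : ℝ) * K.choose L
      ≤ Fintype.card G * (Fintype.card G : ℝ) ^ K := by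
  have hn : (0 : ℝ) < Fintype.card G := by exact_mod_cast Fintype.card_pos
  have key : ∀ S ∈ powersetCard L (univ : Finset (Fin K)),
      #{z : Fin K → G | ((S.sort (· ≤ ·)).map z).prod = g} * Fintype.card G
        = Fintype.card (Fin K → G) := by
    intro S hS
    obtain ⟨i, hi⟩ : S.Nonempty := card_pos.1 ((mem_powersetCard.1 hS).2 ▸ hL)
    simpa using card_filter_bijective_coord (fun z : Fin K → G => ((S.sort (· ≤ ·)).map z).prod)
      (fun _ => True) i (List.bijective_prod_map_update (S.sort_nodup (· ≤ ·)) (by simpa using hi))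
      (by simp) g
  have := card_filter_none_mul_card_le (powersetCard L (univ : Finset (Fin K)))
    (fun S (z : Fin K → G) => ((S.sort (· ≤ ·)).map z).prod = g) hn
    (fun S hS => by exact_mod_cast key S hS) (by
      intro S hS T hT hST
      obtain ⟨i, hi, hi'⟩ : ∃ i ∈ S, i ∉ T := by
        by_contra! h
        exact hST (eq_of_subset_of_card_le h
          (by rw [(mem_powersetCard.1 hS).2, (mem_powersetCard.1 hT).2]))
      have h₂ := card_filter_bijective_coord (fun z : Fin K → G => ((S.sort (· ≤ ·)).map z).prod)
        (fun z : Fin K → G => ((T.sort (· ≤ ·)).map z).prod = g) i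
        (List.bijective_prod_map_update (S.sort_nodup (· ≤ ·)) (by simpa using hi))
        (fun z x => by rw [List.prod_map_update_of_notMem (by simpa using hi')]) g
      have h₃ := key T hT
      rw [← h₂] at h₃
      exact_mod_cast h₃)
  simpa [missedElements] using this

open Finset Classical in
lemma card_many_missed_le {G : Type*} [Group G] [Fintype G] (K : ℕ) {L : ℕ} (hL : 0 < L)
    (hLK : L ≤ K) {τ : ℝ} (hτ : 0 < τ) :
    (#{z : Fin K → G | τ * Fintype.card G < #(missedElements L z)} : ℝ)
      ≤ Fintype.card G / (K.choose L * τ) * (Fintype.card G : ℝ) ^ K := by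
  have hn : (0 : ℝ) < Fintype.card G := by exact_mod_cast Fintype.card_pos
  have hC : (0 : ℝ) < K.choose L := by exact_mod_cast Nat.choose_pos hLK
  set n : ℝ := (Fintype.card G : ℝ) with hndef
  have h1 : (#{z : Fin K → G | τ * n < #(missedElements L z)} : ℝ) * (τ * n)
      ≤ ∑ z : Fin K → G, (#(missedElements L z) : ℝ) := by
    rw [← nsmul_eq_mul, ← sum_const]
    refine (sum_le_sum fun z hz => (mem_filter.1 hz).2.le).trans ?_
    exact sum_le_sum_of_subset_of_nonneg (filter_subset _ _) fun _ _ _ => by positivity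
  have h2 : ∑ z : Fin K → G, (#(missedElements L z) : ℝ)
      = ∑ g : G, (#{z : Fin K → G | g ∈ missedElements L z} : ℝ) := by
    have : ∀ z : Fin K → G, (#(missedElements L z) : ℝ)
        = ∑ g : G, if g ∈ missedElements L z then (1 : ℝ) else 0 := by
      intro z; simp
    simp_rw [this]
    rw [sum_comm]
    simp [sum_boole]
  have h3 : ∑ g : G, (#{z : Fin K → G | g ∈ missedElements L z} : ℝ)
      ≤ n * (n * n ^ K / K.choose L) := by
    refine (sum_le_sum fun g _ => (le_div_iff₀ hC).2 (card_missing_mul_choose_le K hL g)).trans ?_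
    simp [hndef]
  rw [h2] at h1
  have h4 := h1.trans h3
  rw [← le_div_iff₀ (by positivity)] at h4
  refine h4.trans (le_of_eq ?_)
  field_simp

open Finset Classical in
lemma card_uncovered_le {G : Type*} [Group G] [Fintype G] (m : ℕ) (B : Finset G) {τ : ℝ}
    (hB : (#B : ℝ) ≤ τ * Fintype.card G) :
    (#{v : Fin m → G | ∃ g, ∀ i, g * (v i)⁻¹ ∈ B} : ℝ)
      ≤ Fintype.card G * τ ^ m * (Fintype.card G : ℝ) ^ m := by
  have h : ∀ g : G, #{v : Fin m → G | ∀ i, g * (v i)⁻¹ ∈ B} ≤ #B ^ m := by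
    intro g
    calc #{v : Fin m → G | ∀ i, g * (v i)⁻¹ ∈ B}
        ≤ #(Fintype.piFinset fun _ : Fin m => B) := by
          refine card_le_card_of_injOn (fun v i => g * (v i)⁻¹) ?_ ?_
          · intro v hv
            simpa using hv
          · intro v _ v' _ h
            ext1 i
            simpa using congrFun h i
      _ = #B ^ m := by simp
  have h2 : #{v : Fin m → G | ∃ g, ∀ i, g * (v i)⁻¹ ∈ B} ≤ Fintype.card G * #B ^ m := by
    have : ({v : Fin m → G | ∃ g, ∀ i, g * (v i)⁻¹ ∈ B} : Finset _)
        = univ.biUnion fun g => {v : Fin m → G | ∀ i, g * (v i)⁻¹ ∈ B} := by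
      ext v; simp
    rw [this, ← card_univ]
    exact card_biUnion_le_card_mul _ _ _ fun g _ => h g
  calc (#{v : Fin m → G | ∃ g, ∀ i, g * (v i)⁻¹ ∈ B} : ℝ)
      ≤ Fintype.card G * (#B : ℝ) ^ m := by exact_mod_cast h2
    _ ≤ Fintype.card G * (τ * Fintype.card G) ^ m := by gcongr
    _ = _ := by rw [mul_pow]; ring

open Finset Classical in
lemma tupleProb_le_one (G : Type*) [Fintype G] (k : ℕ) (p : (Fin k → G) → Prop) :
    tupleProb G k p ≤ 1 := by
  rw [tupleProb]
  refine div_le_one_of_le₀ ?_ (by positivity)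
  have := Finite.card_subtype_le p
  simpa using (Nat.cast_le (α := ℝ)).2 this

open Finset Classical in
lemma le_tupleProb_forall_exists_list {G : Type*} [Group G] [Fintype G] (K m : ℕ) {L : ℕ}
    (hL : 0 < L) (hLK : L ≤ K) {τ : ℝ} (hτ : 0 < τ) {p : (Fin (K + m) → G) → Prop}
    (hp : ∀ z, (∀ g : G, ∃ l : List (Fin (K + m)), l.length ≤ L + 1 ∧ g = (l.map z).prod) → p z) :
    1 - (Fintype.card G / (K.choose L * τ) + Fintype.card G * τ ^ m) ≤ tupleProb G (K + m) p := by
  have hn : (0 : ℝ) < Fintype.card G := by exact_mod_cast Fintype.card_pos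
  have hgood : ∀ (u : Fin K → G) (v : Fin m → G),
      (¬ ∃ g, ∀ i, g * (v i)⁻¹ ∈ missedElements L u) → p (Fin.append u v) := by
    intro u v h
    push Not at h
    refine hp _ fun g => ?_
    obtain ⟨i, hi⟩ := h g
    simp only [missedElements, mem_filter, mem_univ, true_and, not_forall, not_not] at hi
    obtain ⟨S, hS, e⟩ := hi
    refine ⟨((S.sort (· ≤ ·)).map (Fin.castAdd m)) ++ [Fin.natAdd K i], ?_, ?_⟩
    · simp [(mem_powersetCard.1 hS).2]
    · have : (Fin.append u v) ∘ (Fin.castAdd m) = u := by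
        ext1 j; simp
      simp [this, e]
  have hbad : (#{z : Fin (K + m) → G | ¬ p z} : ℝ)
      ≤ (Fintype.card G / (K.choose L * τ) + Fintype.card G * τ ^ m)
        * (Fintype.card G : ℝ) ^ (K + m) := by
    let U : Finset (Fin K → G) := {u | τ * Fintype.card G < #(missedElements L u)}
    let V : (Fin K → G) → Finset (Fin m → G) :=
      fun u => {v | ∃ g, ∀ i, g * (v i)⁻¹ ∈ missedElements L u}
    have hsub : #{z : Fin (K + m) → G | ¬ p z}
        ≤ #((U ×ˢ (univ : Finset (Fin m → G))) ∪ Uᶜ.biUnion fun u => {u} ×ˢ V u) := by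
      refine card_le_card_of_injOn (Fin.appendEquiv K m).symm ?_
        (Equiv.injective _).injOn
      intro z hz
      obtain ⟨⟨u, v⟩, rfl⟩ := (Fin.appendEquiv K m).surjective z
      have hz' : ¬ p (Fin.append u v) := by simpa [Fin.appendEquiv] using hz
      rw [Equiv.symm_apply_apply]
      by_cases hu : u ∈ U
      · simp [hu]
      · have := mt (hgood u v) hz'
        simp only [coe_union, Set.mem_union, mem_coe, mem_biUnion, mem_product]
        right
        refine ⟨u, by simpa using hu, by simp, ?_⟩
        simpa [V] using not_not.1 this
    have h2 : (#((U ×ˢ (univ : Finset (Fin m → G))) ∪ Uᶜ.biUnion fun u => {u} ×ˢ V u) : ℝ)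
        ≤ #U * (Fintype.card G : ℝ) ^ m + ∑ u ∈ Uᶜ, (#(V u) : ℝ) := by
      refine (Nat.cast_le.2 ((card_union_le _ _).trans (Nat.add_le_add_left card_biUnion_le _))).trans ?_
      simp
    have h3 : ∑ u ∈ Uᶜ, (#(V u) : ℝ) ≤ (Fintype.card G : ℝ) ^ K *
        (Fintype.card G * τ ^ m * (Fintype.card G : ℝ) ^ m) := by
      have : ∀ u ∈ Uᶜ, (#(V u) : ℝ) ≤ Fintype.card G * τ ^ m * (Fintype.card G : ℝ) ^ m := by
        intro u hu
        exact card_uncovered_le m _ (by simpa [U] using hu)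
      refine (sum_le_card_nsmul _ _ _ this).trans ?_
      rw [nsmul_eq_mul]
      gcongr
      have := card_le_univ Uᶜ
      simp only [Fintype.card_pi, prod_const, card_univ, Fintype.card_fin] at this
      exact_mod_cast this
    have h1 := card_many_missed_le (G := G) K hL hLK hτ
    calc (#{z : Fin (K + m) → G | ¬ p z} : ℝ) ≤ _ := (Nat.cast_le.2 hsub).trans h2
      _ ≤ Fintype.card G / (K.choose L * τ) * (Fintype.card G : ℝ) ^ K * (Fintype.card G : ℝ) ^ m
          + (Fintype.card G : ℝ) ^ K * (Fintype.card G * τ ^ m * (Fintype.card G : ℝ) ^ m) := by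
        gcongr
      _ = _ := by rw [pow_add]; ring
  rw [tupleProb, le_div_iff₀ (by positivity), Nat.card_eq_fintype_card, Fintype.card_subtype]
  have htot := card_filter_add_card_filter_not (s := (univ : Finset (Fin (K + m) → G))) p
  have htot' : (#{z : Fin (K + m) → G | p z} : ℝ) + #{z : Fin (K + m) → G | ¬ p z}
      = (Fintype.card G : ℝ) ^ (K + m) := by
    rw [← Nat.cast_add, htot]; simp
  linarith

lemma exists_cayDiam_eq_of_forall_exists_list {G : Type*} [Group G] (undir : Bool) {k L : ℕ}
    (z : Fin k → G) (h : ∀ g : G, ∃ l : List (Fin k), l.length ≤ L ∧ g = (l.map z).prod) :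
    ∃ D : ℕ, cayDiam undir z = (D : ℕ∞) ∧ D ≤ L := by
  have hle : cayDiam undir z ≤ L := by
    refine iSup_le fun x => iSup_le fun y => ?_
    obtain ⟨l, hl, e⟩ := h (x⁻¹ * y)
    have hw : (List.ofFn fun i : Fin l.length => z (l.get i)) = l.map z := by
      apply List.ext_get <;> simp
    have : cayDist undir z x y ≤ (l.length : ℕ∞) :=
      sInf_le ⟨l.length, rfl, fun i => (l.get i, true), fun _ _ => rfl, by
        simp only [if_true]
        rw [hw, ← e]
        group⟩
    exact this.trans (Nat.cast_le.2 hl)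
  obtain ⟨D, hD⟩ := ENat.ne_top_iff_exists.1 (ne_top_of_le_ne_top (ENat.natCast_ne_top L) hle)
  refine ⟨D, hD.symm, ?_⟩
  rw [← hD] at hle
  exact_mod_cast hle

lemma choose_add_le_two_pow_mul_choose {K R : ℕ} (h : 2 * R ≤ K) (m : ℕ) :
    (K + m).choose R ≤ 2 ^ m * K.choose R := by
  induction m with
  | zero => simp
  | succ m ih =>
    have : (K + m + 1).choose R ≤ 2 * (K + m).choose R := by
      cases R with
      | zero => simp
      | succ r =>
        rw [Nat.choose_succ_succ]
        have := Nat.choose_le_succ_of_lt_half_left (r := r) (n := K + m) (by omega)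
        simp only [Nat.succ_eq_add_one] at *
        omega
    calc (K + (m + 1)).choose R ≤ 2 * (K + m).choose R := this
      _ ≤ 2 * (2 ^ m * K.choose R) := by gcongr
      _ = _ := by ring

lemma pow_mul_choose_le_choose_add {K L : ℕ} {y : ℝ} (hy : 0 ≤ y) (hyL : y * L ≤ K - L)
    (R i : ℕ) (hi : R + i ≤ L) : y ^ i * K.choose R ≤ K.choose (R + i) := by
  induction i with
  | zero => simp
  | succ i ih =>
    have ih := ih (by omega)
    have hL : (0 : ℝ) ≤ y * L := by positivity
    have hLK : L ≤ K := by
      have : (L : ℝ) ≤ K := by linarith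
      exact_mod_cast this
    have h := Nat.choose_succ_right_eq K (R + i)
    have h' : (K.choose (R + i + 1) : ℝ) * (R + i + 1) = K.choose (R + i) * (K - (R + i)) := by
      have := congrArg (Nat.cast (R := ℝ)) h
      rw [Nat.cast_mul, Nat.cast_mul, Nat.cast_sub (by omega)] at this
      push_cast at this
      exact this
    have hiL : (R + i + 1 : ℝ) ≤ L := by exact_mod_cast hi
    have hstep : y * (R + i + 1) ≤ K - (R + i) := by
      have : y * (R + i + 1) ≤ y * L := by gcongr
      linarith
    have hpos : (0 : ℝ) < R + i + 1 := by positivity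
    refine le_of_mul_le_mul_right ?_ hpos
    calc y ^ (i + 1) * K.choose R * (R + i + 1)
        = (y ^ i * K.choose R) * (y * (R + i + 1)) := by ring
      _ ≤ K.choose (R + i) * (K - (R + i)) := by gcongr
      _ = _ := h'.symm

lemma choose_mul_pow_self_le (k R : ℕ) : (k.choose R : ℝ) * (R : ℝ) ^ R ≤ (3 * k) ^ R := by
  have h1 : (k.choose R : ℝ) ≤ (k : ℝ) ^ R / R.factorial := Nat.choose_le_pow_div R k
  have h2 := Real.pow_div_factorial_le_exp (R : ℝ) (Nat.cast_nonneg R) R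
  have h3 : Real.exp R ≤ 3 ^ R := by
    rw [← mul_one (R : ℝ), Real.exp_nat_mul]
    gcongr
    exact Real.exp_one_lt_three.le
  calc (k.choose R : ℝ) * (R : ℝ) ^ R ≤ (k : ℝ) ^ R / R.factorial * (R : ℝ) ^ R := by gcongr
    _ = (k : ℝ) ^ R * ((R : ℝ) ^ R / R.factorial) := by ring
    _ ≤ (k : ℝ) ^ R * 3 ^ R := by gcongr; exact h2.trans h3
    _ = _ := by rw [mul_pow]; ring

/-- Increasing the radius by a factor close to `1` multiplies the binomial coefficient by a
power of `n`, even after dropping a bounded number of generators. -/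
lemma exists_radius_mul_rpow_le_choose {c ε : ℝ} (hc : 0 < c) (hc1 : c < 1) (hε : 0 < ε) :
    ∃ s : ℕ, 0 < s ∧ ∃ r₀ k₀ : ℕ, ∀ k n R : ℕ, k₀ ≤ k → r₀ ≤ R →
      2 * (R : ℝ) ≤ (1 - c / 2) * k + 1 → n ≤ k.choose R →
      ∃ L K : ℕ, 0 < L ∧ L ≤ K ∧ k = K + 4 * s ∧ (L : ℝ) + 1 ≤ (1 + ε) * R ∧
        (n : ℝ) * (n : ℝ) ^ (1 / s : ℝ) ≤ 2 ^ (4 * s) * K.choose L := by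
  obtain ⟨q, hq⟩ := exists_nat_ge (max (16 / c) (2 / ε))
  have hqc : 16 / c ≤ q := (le_max_left _ _).trans hq
  have hqε : 2 / ε ≤ q := (le_max_right _ _).trans hq
  have hq16 : (16 : ℝ) ≤ q := by
    refine le_trans ?_ hqc
    rw [le_div_iff₀ hc]; linarith
  have hq0 : 0 < q := by
    have : (0 : ℝ) < q := by linarith
    exact_mod_cast this
  obtain ⟨p, hp⟩ := pow_unbounded_of_one_lt 24 (show 1 < 1 + c / 4 by linarith)
  obtain ⟨r₁, hr₁⟩ := exists_nat_ge (4 / ε)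
  set s := (p + 1) * q with hs
  have hs0 : 0 < s := by positivity
  obtain ⟨k₀, hk₀⟩ := exists_nat_ge (4 * (1 + (4 * s : ℕ)) / c)
  refine ⟨s, hs0, max q r₁, k₀, fun k n R hk hR h2R hn => ?_⟩
  have hRq : q ≤ R := (le_max_left _ _).trans hR
  have hRε : 4 ≤ ε * R := by
    have : 4 / ε ≤ R := hr₁.trans (by exact_mod_cast (le_max_right _ _).trans hR)
    rw [div_le_iff₀ hε] at this; linarith
  set m := 4 * s with hm
  have hkc : 4 * (1 + (m : ℝ)) ≤ c * k := by
    have : 4 * (1 + (m : ℝ)) / c ≤ k := hk₀.trans (by exact_mod_cast hk)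
    rw [div_le_iff₀ hc] at this; linarith
  have hk0 : (0 : ℝ) ≤ k := Nat.cast_nonneg k
  have hkm : 4 * (1 + (m : ℝ)) ≤ k := hkc.trans (mul_le_of_le_one_left hk0 hc1.le)
  obtain ⟨K, rfl⟩ : ∃ K, k = K + m := by
    refine ⟨k - m, ?_⟩
    have : m ≤ k := by
      have : (m : ℝ) ≤ k := by have : (0 : ℝ) ≤ m := Nat.cast_nonneg m
                               linarith
      exact_mod_cast this
    omega
  push_cast at h2R hkc hkm hk0
  have hm0 : (0 : ℝ) ≤ m := Nat.cast_nonneg m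
  have hK0 : (0 : ℝ) ≤ K := Nat.cast_nonneg K
  have hR0 : (0 : ℝ) < R := by
    have : 0 < R := hq0.trans_le hRq
    exact_mod_cast this
  have h2RK : 2 * (R : ℝ) ≤ (1 - c / 4) * K := by linarith [mul_nonneg hc.le hm0]
  set j := R / q + 1 with hj
  have hqj : R ≤ q * j := (Nat.lt_mul_div_succ R hq0).le
  have hq0' : (0 : ℝ) < q := by exact_mod_cast hq0
  have hjle : (j : ℝ) ≤ R / q + 1 := by
    rw [hj]; push_cast
    have : ((R / q : ℕ) : ℝ) ≤ R / q := Nat.cast_div_le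
    linarith
  have hone : 1 ≤ (R : ℝ) / q := by
    rw [one_le_div hq0']; exact_mod_cast hRq
  have hinvc : (R : ℝ) / q ≤ R * (c / 16) := by
    rw [div_eq_mul_inv]
    gcongr
    rw [inv_le_comm₀ hq0' (by positivity), inv_div]; exact hqc
  have hinvε : (R : ℝ) / q ≤ R * (ε / 2) := by
    rw [div_eq_mul_inv]
    gcongr
    rw [inv_le_comm₀ hq0' (by positivity), inv_div]; exact hqε
  set L := R + j with hL
  have hLr : (L : ℝ) = R + j := by rw [hL]; push_cast; ring
  have hL1 : (L : ℝ) ≤ R * (1 + c / 8) := by rw [hLr]; linarith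
  have hLR : (L : ℝ) ≤ 2 * R := by linarith [mul_le_mul_of_nonneg_left hc1.le hR0.le]
  have h2L : 2 * (L : ℝ) ≤ (1 - c / 8) * K := by
    calc 2 * (L : ℝ) ≤ (2 * R) * (1 + c / 8) := by linarith
      _ ≤ ((1 - c / 4) * K) * (1 + c / 8) := by gcongr
      _ ≤ _ := by linarith [mul_nonneg (sq_nonneg c) hK0]
  have hL0 : (0 : ℝ) < L := by rw [hLr]; positivity
  have hLK : 2 * (L : ℝ) ≤ K := h2L.trans (by linarith [mul_nonneg hc.le hK0])
  set y : ℝ := (K - L) / L with hy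
  have hyL : y * L = K - L := by rw [hy]; field_simp
  have hy1 : 1 + c / 4 ≤ y := by
    rw [hy, le_div_iff₀ hL0]
    have : (1 + c / 8) * (2 * (L : ℝ)) ≤ (1 + c / 8) * ((1 - c / 8) * K) := by gcongr
    linarith [mul_nonneg (sq_nonneg c) hK0]
  have hy1' : 1 ≤ y := by linarith
  have hy0 : 0 ≤ y := by linarith
  have h24 : 24 * y ≤ y ^ (p + 1) := by
    rw [pow_succ]
    gcongr
    exact hp.le.trans (by gcongr)
  have h3k : 3 * ((K + m : ℕ) : ℝ) ≤ R * y ^ (p + 1) := by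
    have h1 : 3 * ((K + m : ℕ) : ℝ) ≤ 6 * K := by push_cast; linarith
    have h2 : 6 * (K : ℝ) ≤ 12 * (y * L) := by rw [hyL]; linarith
    have h3 : y * (L : ℝ) ≤ y * (2 * R) := by gcongr
    have h4 : (R : ℝ) * (24 * y) ≤ R * y ^ (p + 1) := by gcongr
    linarith
  have hny : (n : ℝ) ≤ (y ^ j) ^ s := by
    have h1 : (n : ℝ) * (R : ℝ) ^ R ≤ (R * y ^ (p + 1)) ^ R :=
      calc (n : ℝ) * (R : ℝ) ^ R ≤ ((K + m).choose R : ℝ) * (R : ℝ) ^ R := by gcongr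
        _ ≤ (3 * ((K + m : ℕ) : ℝ)) ^ R := choose_mul_pow_self_le _ _
        _ ≤ _ := by gcongr
    rw [mul_pow, mul_comm] at h1
    have h2 := le_of_mul_le_mul_left h1 (by positivity)
    refine h2.trans ?_
    rw [← pow_mul, ← pow_mul]
    refine pow_le_pow_right₀ hy1' ?_
    rw [hs]
    calc (p + 1) * R ≤ (p + 1) * (q * j) := by gcongr
      _ = _ := by ring
  have hroot : (n : ℝ) ^ (1 / s : ℝ) ≤ y ^ j := by
    calc (n : ℝ) ^ (1 / s : ℝ) ≤ ((y ^ j) ^ s) ^ (1 / s : ℝ) := by gcongr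
      _ = y ^ j := by
        rw [one_div, Real.pow_rpow_inv_natCast (by positivity) hs0.ne']
  refine ⟨L, K, by exact_mod_cast hL0, ?_, rfl, ?_, ?_⟩
  · have : (L : ℝ) ≤ K := by linarith
    exact_mod_cast this
  · rw [hLr]; linarith
  · have h1 := pow_mul_choose_le_choose_add hy0 hyL.le R j le_rfl
    have h2 : 2 * R ≤ K := by
      have : 2 * (R : ℝ) ≤ K := by linarith [mul_nonneg hc.le hK0]
      exact_mod_cast this
    have h3 : (n : ℝ) ≤ 2 ^ m * K.choose R := by
      exact_mod_cast hn.trans (choose_add_le_two_pow_mul_choose h2 m)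
    calc (n : ℝ) * (n : ℝ) ^ (1 / s : ℝ) ≤ (2 ^ m * K.choose R) * y ^ j := by gcongr
      _ = 2 ^ m * (y ^ j * K.choose R) := by ring
      _ ≤ 2 ^ m * K.choose L := by gcongr

lemma minBinomRadius_spec {k n t : ℕ} (ht : t ≤ k) (h : (k - t + 1) * n ≤ 2 ^ (k - t)) :
    2 * minBinomRadius k n + t ≤ k ∧ n ≤ k.choose (minBinomRadius k n) := by
  have h1 : 2 ^ (k - t) ≤ (k - t + 1) * (k - t).choose ((k - t) / 2) := by
    rw [← Nat.sum_range_choose]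
    refine (Finset.sum_le_card_nsmul _ _ _ fun i _ => Nat.choose_le_middle i _).trans ?_
    simp
  have h2 : n ≤ k.choose ((k - t) / 2) :=
    (Nat.le_of_mul_le_mul_left (h.trans h1) (by omega)).trans
      (Nat.choose_le_choose _ (by omega))
  have h3 : minBinomRadius k n ≤ (k - t) / 2 := Nat.sInf_le h2
  exact ⟨by omega, Nat.sInf_mem (s := {R : ℕ | n ≤ k.choose R}) ⟨_, h2⟩⟩

lemma exists_minBinomRadius_bound {c : ℝ} (hc : 0 < c) (hc1 : c < 1) :
    ∃ k₀ : ℕ, ∀ k n : ℕ, k₀ ≤ k → 0 < n → Real.log n ≤ (1 - c) * k * Real.log 2 →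
      2 * (minBinomRadius k n : ℝ) ≤ (1 - c / 2) * k + 1 ∧
        n ≤ k.choose (minBinomRadius k n) := by
  have hl2 : 0 < Real.log 2 := Real.log_pos one_lt_two
  set a := c / 2 * Real.log 2 with ha
  have ha0 : 0 < a := by positivity
  obtain ⟨k₀, hk₀⟩ := exists_nat_ge (2 / a ^ 2)
  refine ⟨k₀, fun k n hk hn hlog => ?_⟩
  have hk0 : (0 : ℝ) ≤ k := Nat.cast_nonneg k
  have hka : 2 ≤ k * a ^ 2 := by
    rw [← div_le_iff₀ (by positivity)]
    exact hk₀.trans (by exact_mod_cast hk)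
  have hexp : (k : ℝ) + 1 ≤ Real.exp (a * k) := by
    have h1 := Real.quadratic_le_exp_of_nonneg (show 0 ≤ a * k by positivity)
    have h2 : 2 * (k : ℝ) ≤ k * a ^ 2 * k := by gcongr
    have : 0 ≤ a * k := by positivity
    nlinarith
  set t := ⌊c / 2 * k⌋₊ with ht
  have ht1 : (t : ℝ) ≤ c / 2 * k := Nat.floor_le (by positivity)
  have ht2 : c / 2 * k < t + 1 := Nat.lt_floor_add_one _
  have htk : t ≤ k := by
    have : (t : ℝ) ≤ k := by nlinarith
    exact_mod_cast this
  have hmain : (k - t + 1) * n ≤ 2 ^ (k - t) := by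
    have hn' : (0 : ℝ) < n := by exact_mod_cast hn
    have e : ((2 : ℝ) ^ (k - t)) = Real.exp ((k - t) * Real.log 2) := by
      rw [← Nat.cast_sub htk, Real.exp_nat_mul, Real.exp_log two_pos]
    have : ((k : ℝ) - t + 1) * n ≤ 2 ^ (k - t) := by
      rw [e]
      calc ((k : ℝ) - t + 1) * n ≤ Real.exp (a * k) * Real.exp (Real.log n) := by
            rw [Real.exp_log hn']
            gcongr
            have : (0 : ℝ) ≤ t := Nat.cast_nonneg t
            linarith
        _ = Real.exp (a * k + Real.log n) := (Real.exp_add _ _).symm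
        _ ≤ _ := by
          apply Real.exp_le_exp.2
          have : c / 2 * k * Real.log 2 ≥ t * Real.log 2 := by gcongr
          rw [ha]; linarith
    rw [← Nat.cast_sub htk] at this
    exact_mod_cast this
  obtain ⟨h1, h2⟩ := minBinomRadius_spec htk hmain
  refine ⟨?_, h2⟩
  have : 2 * (minBinomRadius k n : ℝ) + t ≤ k := by exact_mod_cast h1
  linarith

theorem statement5 :
    ∀ (G : ℕ → Type) [∀ N, Group (G N)] [∀ N, Fintype (G N)] (k : ℕ → ℕ),
      (∀ N, 0 < k N) →
      Tendsto (fun N => Fintype.card (G N)) atTop atTop →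
      (0 < Filter.liminf
        (fun N => ((k N : ℝ) - Real.log (Fintype.card (G N)) / Real.log 2) / (k N : ℝ))
        atTop) →
      Tendsto (fun N => Real.log (k N) / Real.log (Fintype.card (G N))) atTop (nhds 0) →
      ∀ undir : Bool, ∀ ε : ℝ, 0 < ε →
        Tendsto (fun N => tupleProb (G N) (k N) fun z =>
            ∃ D : ℕ, cayDiam undir z = (D : ℕ∞) ∧
              (D : ℝ) ≤ (1 + ε) * (minBinomRadius (k N) (Fintype.card (G N)) : ℝ))
          atTop (nhds 1) := by
  intro G _ _ k _ hG hlim hlog undir ε hε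
  set n : ℕ → ℕ := fun N => Fintype.card (G N) with hn
  have hl2 : 0 < Real.log 2 := Real.log_pos one_lt_two
  have hnR : Tendsto (fun N => (n N : ℝ)) atTop atTop := tendsto_natCast_atTop_atTop.comp hG
  have hn1 : ∀ᶠ N in atTop, 1 < n N := hG.eventually_gt_atTop 1
  obtain ⟨c, hc, hc1, hcN⟩ : ∃ c : ℝ, 0 < c ∧ c < 1 ∧ ∀ᶠ N in atTop,
      Real.log (n N) ≤ (1 - c) * k N * Real.log 2 := by
    obtain ⟨c, hcS, hc⟩ : ∃ c ∈ {a : ℝ | ∀ᶠ N in atTop,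
        a ≤ ((k N : ℝ) - Real.log (n N) / Real.log 2) / (k N : ℝ)}, 0 < c := by
      rw [Filter.liminf_eq] at hlim
      by_contra! h
      exact absurd (Real.sSup_nonpos h) (not_le.2 hlim)
    refine ⟨min c (1 / 2), by positivity, (min_le_right _ _).trans_lt (by norm_num), ?_⟩
    filter_upwards [hcS] with N hN
    have hk : (0 : ℝ) < k N := by
      rcases Nat.eq_zero_or_pos (k N) with h | h
      · rw [h] at hN; simp at hN; linarith
      · exact_mod_cast h
    have h1 := (min_le_left c (1 / 2)).trans hN
    rw [le_div_iff₀ hk] at h1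
    have h2 : Real.log (n N) / Real.log 2 ≤ (1 - min c (1 / 2)) * k N := by linarith
    rwa [div_le_iff₀ hl2] at h2
  have hk : Tendsto k atTop atTop := by
    rw [← tendsto_natCast_atTop_iff (R := ℝ)]
    refine tendsto_atTop_mono' _ ?_
      ((Real.tendsto_log_atTop.comp hnR).atTop_div_const hl2)
    filter_upwards [hcN] with N hN
    simp only [Function.comp]
    rw [div_le_iff₀ hl2]
    refine hN.trans ?_
    have : (0 : ℝ) ≤ c * k N * Real.log 2 := by positivity
    linarith
  obtain ⟨s, hs, r₀, k₁, hrad⟩ := exists_radius_mul_rpow_le_choose hc hc1 hε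
  obtain ⟨k₂, hbin⟩ := exists_minBinomRadius_bound hc hc1
  have hbinN : ∀ᶠ N in atTop, 2 * (minBinomRadius (k N) (n N) : ℝ) ≤ (1 - c / 2) * k N + 1 ∧
      n N ≤ (k N).choose (minBinomRadius (k N) (n N)) := by
    filter_upwards [hk.eventually_ge_atTop k₂, hn1, hcN] with N h1 h2 h3
    exact hbin _ _ h1 (by omega) h3
  have hr₀ : ∀ᶠ N in atTop, r₀ ≤ minBinomRadius (k N) (n N) := by
    filter_upwards [hbinN, hn1, hlog.eventually_lt_const (show (0 : ℝ) < 1 / (r₀ + 1) by positivity)]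
      with N h1 h2 h3
    have hln : 0 < Real.log (n N) := Real.log_pos (by exact_mod_cast h2)
    rw [div_lt_div_iff₀ hln (by positivity), one_mul] at h3
    have h4 : Real.log (n N) ≤ minBinomRadius (k N) (n N) * Real.log (k N) := by
      rw [← Real.log_pow]
      apply Real.log_le_log (by exact_mod_cast (by omega : 0 < n N))
      exact_mod_cast h1.2.trans (Nat.choose_le_pow _ _)
    by_contra! h5
    have h6 : (minBinomRadius (k N) (n N) : ℝ) ≤ r₀ + 1 := by
      have : (minBinomRadius (k N) (n N) : ℝ) ≤ r₀ := by exact_mod_cast h5.le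
      linarith
    have h7 : (minBinomRadius (k N) (n N) : ℝ) * Real.log (k N) ≤ (r₀ + 1) * Real.log (k N) :=
      mul_le_mul_of_nonneg_right h6 (Real.log_natCast_nonneg _)
    linarith
  have hs' : (0 : ℝ) < s := by exact_mod_cast hs
  have hlow : Tendsto (fun N => 1 - (2 ^ (4 * s) * (n N : ℝ) ^ (-(1 / (2 * s)) : ℝ) + (n N : ℝ)⁻¹))
      atTop (nhds 1) := by
    have h1 := (tendsto_rpow_neg_atTop (show (0 : ℝ) < 1 / (2 * s) by positivity)).comp hnR
    have h2 := tendsto_inv_atTop_zero.comp hnR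
    simpa using tendsto_const_nhds.sub ((h1.const_mul (2 ^ (4 * s))).add h2) (a := (1 : ℝ))
  refine tendsto_of_tendsto_of_tendsto_of_le_of_le' hlow tendsto_const_nhds ?_
    (Eventually.of_forall fun N => tupleProb_le_one _ _ _)
  filter_upwards [hbinN, hr₀, hn1, hk.eventually_ge_atTop k₁] with N h1 h2 h3 h4
  obtain ⟨L, K, hL, hLK, hKk, hLR, hC⟩ := hrad _ _ _ h4 h2 h1.1 h1.2
  have hn0 : (0 : ℝ) < n N := by exact_mod_cast (by omega : 0 < n N)
  have key := le_tupleProb_forall_exists_list (G := G N) K (4 * s) hL hLK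
    (τ := (n N : ℝ) ^ (-(1 / (2 * s)) : ℝ)) (by positivity)
    (p := fun z => ∃ D : ℕ, cayDiam undir z = (D : ℕ∞) ∧
      (D : ℝ) ≤ (1 + ε) * (minBinomRadius (k N) (n N) : ℝ)) (by
      intro z hz
      obtain ⟨D, hD, hDL⟩ := exists_cayDiam_eq_of_forall_exists_list undir z hz
      refine ⟨D, hD, le_trans ?_ hLR⟩
      exact_mod_cast hDL)
  have hτ : (n N : ℝ) * ((n N : ℝ) ^ (-(1 / (2 * s)) : ℝ)) ^ (4 * s) = (n N : ℝ)⁻¹ := by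
    rw [← Real.rpow_natCast, ← Real.rpow_mul hn0.le]
    have : (-(1 / (2 * s)) * ((4 * s : ℕ) : ℝ) : ℝ) = -2 := by
      push_cast; field_simp; norm_num
    rw [this, Real.rpow_neg hn0.le]
    norm_num
    field_simp
  have hfst : (n N : ℝ) / (K.choose L * (n N : ℝ) ^ (-(1 / (2 * s)) : ℝ))
      ≤ 2 ^ (4 * s) * (n N : ℝ) ^ (-(1 / (2 * s)) : ℝ) := by
    have hC0 : (0 : ℝ) < K.choose L := by exact_mod_cast Nat.choose_pos hLK
    rw [div_le_iff₀ (by positivity)]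
    have e : (n N : ℝ) ^ (-(1 / (2 * s)) : ℝ) * (n N : ℝ) ^ (-(1 / (2 * s)) : ℝ)
        * (n N : ℝ) ^ (1 / s : ℝ) = 1 := by
      rw [← Real.rpow_add hn0, ← Real.rpow_add hn0]
      have : (-(1 / (2 * s)) + -(1 / (2 * s)) + 1 / s : ℝ) = 0 := by field_simp; norm_num
      rw [this, Real.rpow_zero]
    calc (n N : ℝ) = (n N * (n N : ℝ) ^ (1 / s : ℝ))
          * ((n N : ℝ) ^ (-(1 / (2 * s)) : ℝ) * (n N : ℝ) ^ (-(1 / (2 * s)) : ℝ)) := by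
          linear_combination -(n N : ℝ) * e
      _ ≤ (2 ^ (4 * s) * K.choose L)
          * ((n N : ℝ) ^ (-(1 / (2 * s)) : ℝ) * (n N : ℝ) ^ (-(1 / (2 * s)) : ℝ)) := by gcongr
      _ = _ := by ring
  rw [← hKk] at key
  refine le_trans ?_ key
  change 1 - (_ : ℝ) ≤ 1 - ((n N : ℝ) / _ + n N * _)
  rw [hτ]
  linarith
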